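/- Under the assumption that there is a minimum point x* of q²√(det K_H) over Ω̄ lying on the x₁-axis, the mountain pass value satisfies limsup_{ε→0} c_ε / ln(1/ε) ≤ π q²(x*)√(det K_H(x*)) = π min_{Ω̄} q²√(det K_H). Moreover, if x* ∈ Ω (interior), then c_ε ≤ π (min_{Ω̄} q²√(det K_H)) ln(1/ε) + O(1) as ε → 0. -/

import Mathlib

open MeasureTheory Real Filter Topology Set

noncomputable section

/-- The bilinear form `(K_H(x) a | b)` associated with the matrix
`K_H(x) = (k²+|x|²)⁻¹ [[k²+x₂², -x₁x₂],[-x₁x₂, k²+x₁²]]`. -/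
def KHform (k : ℝ) (x a b : ℝ × ℝ) : ℝ :=
  (k ^ 2 + x.1 ^ 2 + x.2 ^ 2)⁻¹ *
    ((k ^ 2 + x.2 ^ 2) * a.1 * b.1 - x.1 * x.2 * a.1 * b.2
      - x.1 * x.2 * a.2 * b.1 + (k ^ 2 + x.1 ^ 2) * a.2 * b.2)

/-- `K_H(x)` applied to a vector `a`. -/
def KHvec (k : ℝ) (x a : ℝ × ℝ) : ℝ × ℝ :=
  ((k ^ 2 + x.1 ^ 2 + x.2 ^ 2)⁻¹ * ((k ^ 2 + x.2 ^ 2) * a.1 - x.1 * x.2 * a.2),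
   (k ^ 2 + x.1 ^ 2 + x.2 ^ 2)⁻¹ * (-(x.1 * x.2) * a.1 + (k ^ 2 + x.1 ^ 2) * a.2))

/-- `det K_H(x) = k²/(k²+|x|²)`. -/
def detKH (k : ℝ) (x : ℝ × ℝ) : ℝ := k ^ 2 / (k ^ 2 + x.1 ^ 2 + x.2 ^ 2)

/-- Gradient of a scalar function on `ℝ²`. -/
def grad (u : ℝ × ℝ → ℝ) (x : ℝ × ℝ) : ℝ × ℝ :=
  (fderiv ℝ u x (1, 0), fderiv ℝ u x (0, 1))

/-- Divergence of a vector field on `ℝ²`. -/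
def div2 (F : ℝ × ℝ → ℝ × ℝ) (x : ℝ × ℝ) : ℝ :=
  fderiv ℝ (fun y => (F y).1) x (1, 0) + fderiv ℝ (fun y => (F y).2) x (0, 1)

/-- The operator `L_H u = -div (K_H(x) ∇u)`. -/
def LH (k : ℝ) (u : ℝ × ℝ → ℝ) (x : ℝ × ℝ) : ℝ :=
  - div2 (fun y => KHvec k y (grad u y)) x

/-- Positive part `t₊ = max (t, 0)`. -/
def pPart (t : ℝ) : ℝ := max t 0

/-- Clockwise rotation through `π/2`: `a^⊥`. -/
def perp2 (a : ℝ × ℝ) : ℝ × ℝ := (a.2, -a.1)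

/-- Euclidean distance in the plane. -/
def dE (a b : ℝ × ℝ) : ℝ := Real.sqrt ((a.1 - b.1) ^ 2 + (a.2 - b.2) ^ 2)

/-- Euclidean diameter of a planar set. -/
def diamE (S : Set (ℝ × ℝ)) : ℝ := sSup {d | ∃ a ∈ S, ∃ b ∈ S, d = dE a b}

/-- Euclidean distance between two planar sets. -/
def distE (A B : Set (ℝ × ℝ)) : ℝ := sInf {d | ∃ a ∈ A, ∃ b ∈ B, d = dE a b}

/-- The function `q² √(det K_H)`. -/
def Qfun (k : ℝ) (q : ℝ × ℝ → ℝ) (x : ℝ × ℝ) : ℝ := q x ^ 2 * Real.sqrt (detKH k x)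

/-- Surrogate for membership in `H(Ω) = H¹₀(Ω)` (with equivalent norm
`‖u‖² = ∫_Ω (K_H ∇u|∇u)`). -/
def MemH (k : ℝ) (Ω : Set (ℝ × ℝ)) (u : ℝ × ℝ → ℝ) : Prop :=
  ContinuousOn u (closure Ω) ∧ ContDiffOn ℝ 1 u Ω ∧ (∀ x ∈ frontier Ω, u x = 0) ∧
    IntegrableOn (fun x => KHform k x (grad u x) (grad u x)) Ω

/-- The energy functional `I_ε`. -/
def Ieps (k p ε : ℝ) (q : ℝ × ℝ → ℝ) (Ω : Set (ℝ × ℝ)) (u : ℝ × ℝ → ℝ) : ℝ :=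
  (1 / 2) * (∫ x in Ω, KHform k x (grad u x) (grad u x))
    - (1 / ((p + 1) * ε ^ 2)) * ∫ x in Ω, pPart (u x - q x * Real.log (1 / ε)) ^ (p + 1)

/-- The mountain pass value `c_ε = inf_{γ ∈ P_ε} max_{t ∈ [0,1]} I_ε(γ(t))`, where
`P_ε` is the collection of paths in `H(Ω)` (continuous for the `H`-norm) joining `0`
to a point with negative energy. -/
def ceps (k p : ℝ) (q : ℝ × ℝ → ℝ) (Ω : Set (ℝ × ℝ)) (ε : ℝ) : ℝ :=
  sInf {c | ∃ γ : ℝ → ℝ × ℝ → ℝ,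
    (∀ t ∈ Icc (0:ℝ) 1, MemH k Ω (γ t)) ∧
    (∀ t ∈ Icc (0:ℝ) 1, ∀ δ > 0, ∃ η > 0, ∀ s ∈ Icc (0:ℝ) 1, |s - t| < η →
      (∫ x in Ω, KHform k x (grad (fun y => γ s y - γ t y) x)
        (grad (fun y => γ s y - γ t y) x)) < δ) ∧
    γ 0 = (fun _ => 0) ∧ Ieps k p ε q Ω (γ 1) < 0 ∧
    c = sSup ((fun t => Ieps k p ε q Ω (γ t)) '' Icc (0:ℝ) 1)}

/-- The Nehari manifold `N_ε`. -/
def Nehari (k p ε : ℝ) (q : ℝ × ℝ → ℝ) (Ω : Set (ℝ × ℝ)) : Set (ℝ × ℝ → ℝ) :=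
  {u | MemH k Ω u ∧ ¬ Set.EqOn u 0 Ω ∧
    (∫ x in Ω, KHform k x (grad u x) (grad u x))
      = (1 / ε ^ 2) * ∫ x in Ω, pPart (u x - q x * Real.log (1 / ε)) ^ p * u x}

/-- `u` is a (classical) solution of `L_H u = ε⁻²(u - q ln(1/ε))₊ᵖ` in `Ω`, `u = 0` on `∂Ω`. -/
def IsSolution (k p ε : ℝ) (q : ℝ × ℝ → ℝ) (Ω : Set (ℝ × ℝ)) (u : ℝ × ℝ → ℝ) : Prop :=
  ContinuousOn u (closure Ω) ∧ ContDiffOn ℝ 2 u Ω ∧ (∀ x ∈ frontier Ω, u x = 0) ∧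
    ∀ x ∈ Ω, LH k u x = (1 / ε ^ 2) * pPart (u x - q x * Real.log (1 / ε)) ^ p

/-- `u` is a mountain pass solution: a solution at the mountain pass level `c_ε`. -/
def IsMPSolution (k p ε : ℝ) (q : ℝ × ℝ → ℝ) (Ω : Set (ℝ × ℝ)) (u : ℝ × ℝ → ℝ) : Prop :=
  IsSolution k p ε q Ω u ∧ MemH k Ω u ∧ Ieps k p ε q Ω u = ceps k p q Ω ε

/-- The vortex core `A_ε = {x ∈ Ω : u(x) > q(x) ln(1/ε)}`. -/
def vcore (q : ℝ × ℝ → ℝ) (Ω : Set (ℝ × ℝ)) (ε : ℝ) (u : ℝ × ℝ → ℝ) : Set (ℝ × ℝ) :=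
  {x ∈ Ω | q x * Real.log (1 / ε) < u x}


/-- The quadratic form of `K_H(x0)⁻¹` evaluated at `x - x0`. -/
def rhoF (k : ℝ) (x0 x : ℝ × ℝ) : ℝ :=
  (x.1 - x0.1) ^ 2 + (x.2 - x0.2) ^ 2
    + (x0.1 * (x.1 - x0.1) + x0.2 * (x.2 - x0.2)) ^ 2 / k ^ 2

lemma polar_radial (G : ℝ → ℝ) :
    ∫ z : ℝ × ℝ, G (z.1 ^ 2 + z.2 ^ 2) = 2 * π * ∫ r in Ioi (0:ℝ), r * G (r ^ 2) := by
  rw [← integral_comp_polarCoord_symm]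
  have h1 : ∀ p : ℝ × ℝ, p.1 • G ((polarCoord.symm p).1 ^ 2 + (polarCoord.symm p).2 ^ 2)
      = (p.1 * G (p.1 ^ 2)) * 1 := by
    intro p
    have : (polarCoord.symm p).1 ^ 2 + (polarCoord.symm p).2 ^ 2 = p.1 ^ 2 := by
      simp only [polarCoord_symm_apply]
      nlinarith [Real.sin_sq_add_cos_sq p.2]
    rw [this]; simp
  simp_rw [h1]
  rw [polarCoord_target, Measure.volume_eq_prod, setIntegral_prod_mul (fun r : ℝ => r * G (r ^ 2)) (fun _ => (1:ℝ))]
  simp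
  rw [max_eq_left (by linarith [pi_pos])]
  ring

lemma linear_radial (k : ℝ) (hk : 0 < k) (x0 : ℝ × ℝ) (G : ℝ → ℝ) :
    ∫ x : ℝ × ℝ, G (rhoF k x0 x)
      = Real.sqrt (detKH k x0) * ∫ z : ℝ × ℝ, G (z.1 ^ 2 + z.2 ^ 2) := by
  set a := x0.1
  set b := x0.2
  have hA : 0 < 1 + a ^ 2 / k ^ 2 := by positivity
  set α := Real.sqrt (1 + a ^ 2 / k ^ 2) with hα
  have hα2 : α ^ 2 = 1 + a ^ 2 / k ^ 2 := Real.sq_sqrt hA.le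
  have hαp : 0 < α := Real.sqrt_pos.2 hA
  set β := (a * b / k ^ 2) / α with hβ
  set D := (k ^ 2 + a ^ 2 + b ^ 2) / k ^ 2 with hD
  have hDp : 0 < D := by positivity
  set δ := Real.sqrt D / α with hδ
  have hαβ : α * β = a * b / k ^ 2 := by rw [hβ]; field_simp
  have hαδ : α * δ = Real.sqrt D := by rw [hδ]; field_simp
  have hbd : β ^ 2 + δ ^ 2 = 1 + b ^ 2 / k ^ 2 := by
    have h1 : α ^ 2 * (β ^ 2 + δ ^ 2) = α ^ 2 * (1 + b ^ 2 / k ^ 2) := by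
      have : α ^ 2 * (β ^ 2 + δ ^ 2) = (α * β) ^ 2 + (α * δ) ^ 2 := by ring
      rw [this, hαβ, hαδ, Real.sq_sqrt hDp.le, hα2, hD]
      field_simp
      ring
    exact mul_left_cancel₀ (by positivity) h1
  set f : (ℝ × ℝ) →ₗ[ℝ] (ℝ × ℝ) :=
    Matrix.toLin (Module.Basis.finTwoProd ℝ) (Module.Basis.finTwoProd ℝ) !![α, β; 0, δ] with hf
  have hdet : LinearMap.det f = Real.sqrt D := by
    rw [hf, LinearMap.det_toLin, Matrix.det_fin_two_of, ← hαδ]; ring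
  have hdet0 : LinearMap.det f ≠ 0 := by rw [hdet]; exact (Real.sqrt_pos.2 hDp).ne'
  have hfx : ∀ d : ℝ × ℝ, f d = (α * d.1 + β * d.2, δ * d.2) := by
    intro d; rw [hf, Matrix.toLin_finTwoProd_apply]; simp
  have hrho : ∀ d : ℝ × ℝ, rhoF k x0 (d + x0) = (f d).1 ^ 2 + (f d).2 ^ 2 := by
    intro d
    rw [hfx]
    simp only [rhoF, Prod.fst_add, Prod.snd_add, add_sub_cancel_right]
    have : (α * d.1 + β * d.2) ^ 2 + (δ * d.2) ^ 2
      = α ^ 2 * d.1 ^ 2 + 2 * (α * β) * d.1 * d.2 + (β ^ 2 + δ ^ 2) * d.2 ^ 2 := by ring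
    rw [this, hα2, hαβ, hbd]
    field_simp
    ring
  rw [← integral_add_right_eq_self (fun x => G (rhoF k x0 x)) x0]
  simp_rw [hrho]
  have hinv : Measurable f ∧ Function.Injective f := by
    refine ⟨(LinearMap.continuous_of_finiteDimensional f).measurable, ?_⟩
    have hu : IsUnit (LinearMap.det f) := isUnit_iff_ne_zero.2 hdet0
    intro x y hxy
    apply (LinearMap.equivOfIsUnitDet hu).injective
    simpa using hxy
  have hemb : MeasurableEmbedding f :=
    (LinearMap.continuous_of_finiteDimensional f).measurableEmbedding hinv.2
  rw [← hemb.integral_map (fun z : ℝ × ℝ => G (z.1 ^ 2 + z.2 ^ 2)) (μ := volume),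
    Measure.map_linearMap_addHaar_eq_smul_addHaar volume hdet0, integral_smul_measure, hdet,
    ENNReal.toReal_ofReal (abs_nonneg _), abs_of_pos (inv_pos.2 (Real.sqrt_pos.2 hDp)), smul_eq_mul]
  congr 1
  rw [← Real.sqrt_inv, hD, inv_div]; rfl

lemma rhoF_nonneg (k : ℝ) (x0 x : ℝ × ℝ) : 0 ≤ rhoF k x0 x := by
  unfold rhoF; positivity

lemma rhoF_continuous (k : ℝ) (x0 : ℝ × ℝ) : Continuous (rhoF k x0) := by
  unfold rhoF; fun_prop

lemma dist_sq_le_rhoF (k : ℝ) (x0 x : ℝ × ℝ) : dist x x0 ^ 2 ≤ rhoF k x0 x := by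
  have h3 : 0 ≤ (x0.1 * (x.1 - x0.1) + x0.2 * (x.2 - x0.2)) ^ 2 / k ^ 2 := by positivity
  rw [Prod.dist_eq, Real.dist_eq, Real.dist_eq]
  unfold rhoF
  rcases max_cases |x.1 - x0.1| |x.2 - x0.2| with h | h <;> rw [h.1, sq_abs] <;>
    nlinarith [sq_nonneg (x.1 - x0.1), sq_nonneg (x.2 - x0.2)]

lemma dist_le_sqrt_rhoF (k : ℝ) (x0 x : ℝ × ℝ) : dist x x0 ≤ Real.sqrt (rhoF k x0 x) :=
  Real.le_sqrt_of_sq_le (dist_sq_le_rhoF k x0 x)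

lemma rhoF_le (k : ℝ) (hk : 0 < k) (x0 x : ℝ × ℝ) :
    rhoF k x0 x ≤ (2 * (1 + (x0.1 ^ 2 + x0.2 ^ 2) / k ^ 2)) ^ 2 * dist x x0 ^ 2 := by
  set S := (x0.1 ^ 2 + x0.2 ^ 2) / k ^ 2 with hS
  have hS0 : 0 ≤ S := by positivity
  have h1 : (x.1 - x0.1) ^ 2 ≤ dist x x0 ^ 2 := by
    rw [← sq_abs (x.1 - x0.1)]
    refine pow_le_pow_left₀ (abs_nonneg _) ?_ 2
    rw [Prod.dist_eq, Real.dist_eq]; exact le_max_left _ _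
  have h2 : (x.2 - x0.2) ^ 2 ≤ dist x x0 ^ 2 := by
    rw [← sq_abs (x.2 - x0.2)]
    refine pow_le_pow_left₀ (abs_nonneg _) ?_ 2
    rw [Prod.dist_eq, Real.dist_eq, Real.dist_eq]; exact le_max_right _ _
  have h3 : (x0.1 * (x.1 - x0.1) + x0.2 * (x.2 - x0.2)) ^ 2 / k ^ 2
      ≤ S * ((x.1 - x0.1) ^ 2 + (x.2 - x0.2) ^ 2) := by
    rw [hS, div_mul_eq_mul_div]
    apply div_le_div_of_nonneg_right _ (by positivity)
    nlinarith [sq_nonneg (x0.1 * (x.2 - x0.2) - x0.2 * (x.1 - x0.1))]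
  unfold rhoF
  have h4 : (x.1 - x0.1) ^ 2 + (x.2 - x0.2) ^ 2 ≤ 2 * dist x x0 ^ 2 := by linarith
  have h5 : (1 + S) * ((x.1 - x0.1) ^ 2 + (x.2 - x0.2) ^ 2) ≤ (1 + S) * (2 * dist x x0 ^ 2) :=
    mul_le_mul_of_nonneg_left h4 (by linarith)
  have h6 : 0 ≤ dist x x0 ^ 2 := sq_nonneg _
  nlinarith [mul_nonneg hS0 h6, mul_nonneg (mul_nonneg hS0 hS0) h6]

/-- Radial majorant of the energy density. -/
def GF (R ε M : ℝ) : ℝ → ℝ :=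
  indicator (Iio (R ^ 2)) (fun s => 1 / (s + ε ^ 2) + M * Real.sqrt s / (s + ε ^ 2))

lemma GF_nonneg (R ε M : ℝ) (hM : 0 ≤ M) (s : ℝ) (hs : 0 ≤ s) : 0 ≤ GF R ε M s := by
  unfold GF
  by_cases h : s ∈ Iio (R ^ 2)
  · rw [indicator_of_mem h]; positivity
  · rw [indicator_of_notMem h]

lemma GF_integrable (k : ℝ) (x0 : ℝ × ℝ) (R ε M : ℝ) (hR : 0 < R) (hε : 0 < ε) :
    Integrable (fun x => GF R ε M (rhoF k x0 x)) := by
  have hS : MeasurableSet {x | rhoF k x0 x < R ^ 2} :=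
    (isOpen_lt (rhoF_continuous k x0) continuous_const).measurableSet
  have hc : Continuous (fun x => 1 / (rhoF k x0 x + ε ^ 2)
      + M * Real.sqrt (rhoF k x0 x) / (rhoF k x0 x + ε ^ 2)) := by
    have h0 : ∀ x, rhoF k x0 x + ε ^ 2 ≠ 0 := fun x => by
      have := rhoF_nonneg k x0 x; positivity
    have hr := rhoF_continuous k x0
    exact (continuous_const.div (hr.add continuous_const) h0).add
      ((continuous_const.mul hr.sqrt).div (hr.add continuous_const) h0)
  have : (fun x => GF R ε M (rhoF k x0 x)) = indicator {x | rhoF k x0 x < R ^ 2}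
      (fun x => 1 / (rhoF k x0 x + ε ^ 2)
      + M * Real.sqrt (rhoF k x0 x) / (rhoF k x0 x + ε ^ 2)) := by
    ext x
    by_cases h : rhoF k x0 x < R ^ 2
    · rw [indicator_of_mem (by exact h), GF, indicator_of_mem (by exact h)]
    · rw [indicator_of_notMem (by exact h), GF, indicator_of_notMem (by exact h)]
  rw [this, integrable_indicator_iff hS]
  refine (hc.continuousOn.integrableOn_compact (isCompact_closedBall x0 R)).mono_set ?_
  intro x hx
  rw [Metric.mem_closedBall]
  have h1 : dist x x0 ^ 2 < R ^ 2 := lt_of_le_of_lt (dist_sq_le_rhoF k x0 x) hx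
  exact (lt_of_pow_lt_pow_left₀ 2 hR.le h1).le

lemma GF_integral (k : ℝ) (hk : 0 < k) (x0 : ℝ × ℝ) (R ε M : ℝ) (hR : 0 < R) (hε : 0 < ε)
    (hM : 0 ≤ M) :
    ∫ x, GF R ε M (rhoF k x0 x)
      ≤ Real.sqrt (detKH k x0) * (2 * π *
        (1 / 2 * (Real.log (R ^ 2 + ε ^ 2) - Real.log (ε ^ 2)) + M * R)) := by
  rw [linear_radial k hk, polar_radial]
  refine mul_le_mul_of_nonneg_left ?_ (Real.sqrt_nonneg _)
  refine mul_le_mul_of_nonneg_left ?_ (by positivity)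
  have hpos : ∀ r : ℝ, r ^ 2 + ε ^ 2 ≠ 0 := fun r => by positivity
  have hcont : Continuous (fun r : ℝ => r / (r ^ 2 + ε ^ 2) + M) :=
    (continuous_id.div (by fun_prop) hpos).add continuous_const
  have hint : ∫ r in (0:ℝ)..R, (r / (r ^ 2 + ε ^ 2) + M)
      = 1 / 2 * (Real.log (R ^ 2 + ε ^ 2) - Real.log (ε ^ 2)) + M * R := by
    have hd : ∀ r ∈ uIcc (0:ℝ) R, HasDerivAt
        (fun r => 1 / 2 * Real.log (r ^ 2 + ε ^ 2) + M * r) (r / (r ^ 2 + ε ^ 2) + M) r := by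
      intro r _
      have h1 : HasDerivAt (fun r : ℝ => r ^ 2 + ε ^ 2) (2 * r) r := by
        simpa using (hasDerivAt_pow 2 r).add_const (ε ^ 2)
      have h2 := ((h1.log (hpos r)).const_mul (1 / 2)).add ((hasDerivAt_id r).const_mul M)
      convert! h2 using 1
      have := hpos r
      field_simp
    rw [intervalIntegral.integral_eq_sub_of_hasDerivAt hd (hcont.intervalIntegrable _ _)]
    simp only [ne_eq, OfNat.ofNat_ne_zero, not_false_eq_true, zero_pow, zero_add, mul_zero, add_zero]
    ring
  rw [← hint, intervalIntegral.integral_of_le hR.le]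
  have e1 : ∫ r in Ioc 0 R, (r / (r ^ 2 + ε ^ 2) + M)
      = ∫ r in Ioi (0:ℝ), indicator (Iic R) (fun r => r / (r ^ 2 + ε ^ 2) + M) r := by
    rw [setIntegral_indicator measurableSet_Iic, Ioi_inter_Iic]
  rw [e1]
  refine integral_mono_of_nonneg ?_ ?_ ?_
  · filter_upwards [ae_restrict_mem measurableSet_Ioi] with r hr
    exact mul_nonneg (le_of_lt hr) (GF_nonneg R ε M hM _ (sq_nonneg r))
  · rw [integrable_indicator_iff measurableSet_Iic, IntegrableOn, Measure.restrict_restrict measurableSet_Iic, inter_comm,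
      Ioi_inter_Iic]
    exact hcont.integrableOn_Ioc
  · filter_upwards [ae_restrict_mem measurableSet_Ioi] with r hr
    have hr0 : 0 < r := hr
    by_cases h : r ^ 2 < R ^ 2
    · have hrR : r < R := lt_of_pow_lt_pow_left₀ 2 hR.le h
      rw [indicator_of_mem (by exact hrR.le), GF, indicator_of_mem (by exact h), Real.sqrt_sq hr0.le]
      have : r * (1 / (r ^ 2 + ε ^ 2) + M * r / (r ^ 2 + ε ^ 2))
          = r / (r ^ 2 + ε ^ 2) + M * (r ^ 2 / (r ^ 2 + ε ^ 2)) := by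
        ring
      rw [this]
      have h3 : r ^ 2 / (r ^ 2 + ε ^ 2) ≤ 1 := by
        rw [div_le_one (by positivity)]; linarith [sq_nonneg ε]
      nlinarith
    · rw [GF, indicator_of_notMem (by exact h), mul_zero]
      rw [indicator_apply]
      split_ifs
      · positivity
      · exact le_rfl

lemma hasDerivAt_posSq (y : ℝ) : HasDerivAt (fun y : ℝ => max y 0 ^ 2) (2 * max y 0) y := by
  rcases lt_trichotomy y 0 with h | h | h
  · rw [max_eq_right h.le, mul_zero]
    refine (hasDerivAt_const y (0:ℝ)).congr_of_eventuallyEq ?_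
    filter_upwards [Iio_mem_nhds h] with z hz
    rw [max_eq_right (le_of_lt hz)]; norm_num
  · subst h
    rw [max_self, mul_zero, hasDerivAt_iff_isLittleO]
    have h2 : (fun y : ℝ => y ^ 2) =o[𝓝 0] (fun y : ℝ => y) := by
      simpa using Asymptotics.isLittleO_pow_id (𝕜 := ℝ) (n := 2) (by norm_num)
    have h3 : (fun y : ℝ => max y 0 ^ 2) =O[𝓝 0] (fun y : ℝ => y ^ 2) := by
      refine Asymptotics.IsBigO.of_bound 1 (Eventually.of_forall fun z => ?_)
      rw [one_mul, Real.norm_eq_abs, Real.norm_eq_abs, abs_of_nonneg (sq_nonneg _),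
        abs_of_nonneg (sq_nonneg _)]
      rcases max_cases z 0 with h | h <;> rw [h.1]
      norm_num
      positivity
    simpa using h3.trans_isLittleO h2
  · rw [max_eq_left h.le]
    have := hasDerivAt_pow 2 y
    simp at this
    refine this.congr_of_eventuallyEq ?_
    filter_upwards [Ioi_mem_nhds h] with z hz
    rw [max_eq_left (le_of_lt hz)]

/-- A `C¹` regularisation of the positive part. -/
def hF (y : ℝ) : ℝ := (max y 0 ^ 2 - max (y - 1) 0 ^ 2) / 2

/-- Derivative of `hF`. -/
def hF' (y : ℝ) : ℝ := max y 0 - max (y - 1) 0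

lemma hF_hasDerivAt (y : ℝ) : HasDerivAt hF (hF' y) y := by
  have h2 : HasDerivAt (fun y : ℝ => max (y - 1) 0 ^ 2) (2 * max (y - 1) 0) y :=
    HasDerivAt.comp_sub_const y 1 (hasDerivAt_posSq (y - 1))
  have h3 := ((hasDerivAt_posSq y).sub h2).div_const 2
  convert! h3 using 1
  unfold hF'; ring

lemma hF'_nonneg (y : ℝ) : 0 ≤ hF' y := by
  unfold hF'
  have := max_le_max_right 0 (show y - 1 ≤ y by linarith)
  linarith

lemma hF'_le (y : ℝ) : hF' y ≤ 1 := by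
  unfold hF'
  rcases max_cases y 0 with h | h <;> rcases max_cases (y - 1) 0 with h' | h' <;> linarith

lemma hF'_of_nonpos (y : ℝ) (hy : y ≤ 0) : hF' y = 0 := by
  unfold hF'; rw [max_eq_right hy, max_eq_right (by linarith)]; norm_num

lemma hF_of_nonpos (y : ℝ) (hy : y ≤ 0) : hF y = 0 := by
  unfold hF; rw [max_eq_right hy, max_eq_right (by linarith)]; norm_num

lemma le_hF (y : ℝ) : y - 1 / 2 ≤ hF y := by
  unfold hF
  rcases max_cases y 0 with h | h <;> rcases max_cases (y - 1) 0 with h' | h' <;>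
    rw [h.1, h'.1] <;> nlinarith [sq_nonneg (y - 1)]

lemma hF_contDiff : ContDiff ℝ 1 hF := by
  rw [contDiff_one_iff_deriv]
  refine ⟨fun y => (hF_hasDerivAt y).differentiableAt, ?_⟩
  have : deriv hF = hF' := funext fun y => (hF_hasDerivAt y).deriv
  rw [this]; unfold hF'; fun_prop

/-- Argument of the truncated logarithm. -/
def yF (k R ε : ℝ) (x0 x : ℝ × ℝ) : ℝ :=
  1 / 2 * (Real.log (R ^ 2) - Real.log (rhoF k x0 x + ε ^ 2))

/-- The test function. -/
def vF (k R ε : ℝ) (x0 x : ℝ × ℝ) : ℝ := hF (yF k R ε x0 x)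

lemma vF_contDiff (k R ε : ℝ) (x0 : ℝ × ℝ) (hε : 0 < ε) : ContDiff ℝ 1 (vF k R ε x0) := by
  refine hF_contDiff.comp ?_
  have h1 : ContDiff ℝ 1 (fun x => rhoF k x0 x + ε ^ 2) := by unfold rhoF; fun_prop
  have h2 := h1.log (fun x => by have := rhoF_nonneg k x0 x; positivity)
  exact contDiff_const.mul (contDiff_const.sub h2)

lemma yF_nonpos (k R ε : ℝ) (hR : 0 < R) (hε : 0 < ε) (x0 x : ℝ × ℝ)
    (h : R ^ 2 ≤ rhoF k x0 x) : yF k R ε x0 x ≤ 0 := by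
  unfold yF
  have : Real.log (R ^ 2) ≤ Real.log (rhoF k x0 x + ε ^ 2) :=
    Real.log_le_log (by positivity) (by nlinarith)
  linarith

/-- Gradient of `rhoF`. -/
def gRho (k : ℝ) (x0 x : ℝ × ℝ) : ℝ × ℝ :=
  (2 * (x.1 - x0.1) + 2 * (x0.1 * (x.1 - x0.1) + x0.2 * (x.2 - x0.2)) * x0.1 / k ^ 2,
   2 * (x.2 - x0.2) + 2 * (x0.1 * (x.1 - x0.1) + x0.2 * (x.2 - x0.2)) * x0.2 / k ^ 2)

lemma grad_vF (k R ε : ℝ) (x0 x : ℝ × ℝ) (hε : 0 < ε) :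
    grad (vF k R ε x0) x
      = (hF' (yF k R ε x0 x) * (-(1 / 2) / (rhoF k x0 x + ε ^ 2))) • gRho k x0 x := by
  have hpos : rhoF k x0 x + ε ^ 2 ≠ 0 := by have := rhoF_nonneg k x0 x; positivity
  have hd1 : HasFDerivAt (fun x : ℝ × ℝ => x.1 - x0.1) (ContinuousLinearMap.fst ℝ ℝ ℝ) x :=
    hasFDerivAt_fst.sub_const _
  have hd2 : HasFDerivAt (fun x : ℝ × ℝ => x.2 - x0.2) (ContinuousLinearMap.snd ℝ ℝ ℝ) x :=
    hasFDerivAt_snd.sub_const _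
  have hrho : HasFDerivAt (fun x => rhoF k x0 x + ε ^ 2) _ x :=
    (((hd1.pow 2).add (hd2.pow 2)).add
      ((((hd1.const_mul x0.1).add (hd2.const_mul x0.2)).pow 2).mul_const ((k ^ 2)⁻¹))).add_const (ε ^ 2)
  have hy := ((hrho.log hpos).const_sub (Real.log (R ^ 2))).const_mul (1 / 2)
  have hv := (hF_hasDerivAt (yF k R ε x0 x)).comp_hasFDerivAt x hy
  have hv' : HasFDerivAt (vF k R ε x0) _ x := hv
  unfold grad
  rw [hv'.fderiv]
  ext <;> simp [gRho] <;> field_simp <;> ring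

lemma KHform_gRho (k : ℝ) (hk : 0 < k) (x0 x : ℝ × ℝ) :
    KHform k x0 (gRho k x0 x) (gRho k x0 x) = 4 * rhoF k x0 x := by
  unfold KHform gRho rhoF
  have : k ^ 2 + x0.1 ^ 2 + x0.2 ^ 2 ≠ 0 := by positivity
  field_simp
  ring

lemma KHform_smul (k c : ℝ) (x a : ℝ × ℝ) :
    KHform k x (c • a) (c • a) = c ^ 2 * KHform k x a a := by
  unfold KHform; simp only [Prod.smul_fst, Prod.smul_snd, smul_eq_mul]; ring

lemma KHform_eq (k : ℝ) (x a : ℝ × ℝ) :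
    KHform k x a a = (k ^ 2 * (a.1 ^ 2 + a.2 ^ 2) + (x.2 * a.1 - x.1 * a.2) ^ 2)
      / (k ^ 2 + x.1 ^ 2 + x.2 ^ 2) := by
  unfold KHform; ring

lemma KHform_nonneg (k : ℝ) (x a : ℝ × ℝ) : 0 ≤ KHform k x a a := by
  rw [KHform_eq]; positivity

lemma KHform_pert (k : ℝ) (hk : 0 < k) (x0 : ℝ × ℝ) :
    ∃ M ≥ 0, ∃ r > 0, ∀ x ∈ Metric.ball x0 r, ∀ a,
      KHform k x a a ≤ (1 + M * dist x x0) * KHform k x0 a a := by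
  have hden : ∀ x : ℝ × ℝ, k ^ 2 + x.1 ^ 2 + x.2 ^ 2 ≠ 0 := fun x => by positivity
  let F : ℝ × ℝ → ℝ × ℝ × ℝ := fun x =>
    ((k ^ 2 + x.1 ^ 2 + x.2 ^ 2)⁻¹ * (k ^ 2 + x.2 ^ 2),
     (k ^ 2 + x.1 ^ 2 + x.2 ^ 2)⁻¹ * (x.1 * x.2),
     (k ^ 2 + x.1 ^ 2 + x.2 ^ 2)⁻¹ * (k ^ 2 + x.1 ^ 2))
  have hF : ContDiff ℝ 1 F := by
    have h1 : ContDiff ℝ 1 (fun x : ℝ × ℝ => (k ^ 2 + x.1 ^ 2 + x.2 ^ 2)⁻¹) :=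
      ContDiff.inv (by fun_prop) hden
    exact (h1.mul (by fun_prop)).prodMk ((h1.mul (by fun_prop)).prodMk (h1.mul (by fun_prop)))
  obtain ⟨K, t, ht, hL⟩ := hF.contDiffAt (x := x0).exists_lipschitzOnWith
  obtain ⟨r, hr, hrt⟩ := Metric.mem_nhds_iff.1 ht
  set c := (k ^ 2 + x0.1 ^ 2 + x0.2 ^ 2) / k ^ 2 with hc
  have hc0 : 0 < c := by positivity
  refine ⟨2 * K * c, by positivity, r, hr, fun x hx a => ?_⟩
  have hx0 : x0 ∈ t := mem_of_mem_nhds ht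
  have hd := hL.dist_le_mul x (hrt hx) x0 hx0
  rw [Prod.dist_eq, Prod.dist_eq] at hd
  have d1 := (le_max_left _ _).trans hd
  have d2 := ((le_max_left _ _).trans (le_max_right _ _)).trans hd
  have d3 := ((le_max_right _ _).trans (le_max_right _ _)).trans hd
  rw [Real.dist_eq] at d1 d2 d3
  set E := (K : ℝ) * dist x x0 with hE
  have hE0 : 0 ≤ E := by positivity
  have hform : ∀ x, KHform k x a a = (F x).1 * a.1 ^ 2 - 2 * (F x).2.1 * (a.1 * a.2)
      + (F x).2.2 * a.2 ^ 2 := by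
    intro x; simp only [KHform, F]; ring
  have hlow : a.1 ^ 2 + a.2 ^ 2 ≤ c * KHform k x0 a a := by
    rw [KHform_eq, hc, div_mul_div_comm, le_div_iff₀ (by positivity)]
    have : 0 ≤ (x0.2 * a.1 - x0.1 * a.2) ^ 2 * (k ^ 2 + x0.1 ^ 2 + x0.2 ^ 2) := by positivity
    nlinarith
  have hdiff : KHform k x a a - KHform k x0 a a ≤ 2 * E * (a.1 ^ 2 + a.2 ^ 2) := by
    rw [hform x, hform x0]
    have e1 : ((F x).1 - (F x0).1) * a.1 ^ 2 ≤ E * a.1 ^ 2 :=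
      mul_le_mul_of_nonneg_right ((le_abs_self _).trans d1) (sq_nonneg _)
    have e3 : ((F x).2.2 - (F x0).2.2) * a.2 ^ 2 ≤ E * a.2 ^ 2 :=
      mul_le_mul_of_nonneg_right ((le_abs_self _).trans d3) (sq_nonneg _)
    have e2 : -(((F x).2.1 - (F x0).2.1) * (2 * (a.1 * a.2))) ≤ E * (a.1 ^ 2 + a.2 ^ 2) := by
      refine (neg_le_abs _).trans ?_
      rw [abs_mul]
      refine mul_le_mul d2 ?_ (abs_nonneg _) hE0
      rw [abs_le]
      constructor <;> nlinarith [sq_nonneg (a.1 + a.2), sq_nonneg (a.1 - a.2)]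
    linarith
  have : 2 * E * (a.1 ^ 2 + a.2 ^ 2) ≤ 2 * E * (c * KHform k x0 a a) :=
    mul_le_mul_of_nonneg_left hlow (by positivity)
  have e4 : 2 * E * (c * KHform k x0 a a) = (2 * K * c * dist x x0) * KHform k x0 a a := by
    rw [hE]; ring
  linarith

lemma energy_pointwise (k : ℝ) (hk : 0 < k) (x0 : ℝ × ℝ) (M r R ε : ℝ) (hM : 0 ≤ M)
    (hR : 0 < R) (hRr : R ≤ r) (hε : 0 < ε)
    (hK : ∀ x ∈ Metric.ball x0 r, ∀ a,
      KHform k x a a ≤ (1 + M * dist x x0) * KHform k x0 a a) (x : ℝ × ℝ) :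
    KHform k x (grad (vF k R ε x0) x) (grad (vF k R ε x0) x) ≤ GF R ε M (rhoF k x0 x) := by
  rw [grad_vF k R ε x0 x hε, KHform_smul]
  have hρ := rhoF_nonneg k x0 x
  by_cases h : rhoF k x0 x < R ^ 2
  · rw [GF, indicator_of_mem (by exact h)]
    have h1 : dist x x0 < R :=
      lt_of_pow_lt_pow_left₀ 2 hR.le (lt_of_le_of_lt (dist_sq_le_rhoF k x0 x) h)
    have h2 := hK x (Metric.mem_ball.2 (h1.trans_le hRr)) (gRho k x0 x)
    rw [KHform_gRho k hk] at h2
    set ρ := rhoF k x0 x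
    have h3 : dist x x0 ≤ Real.sqrt ρ := dist_le_sqrt_rhoF k x0 x
    set D := ρ + ε ^ 2 with hD
    have hDp : 0 < D := by positivity
    have h4 : (1 + M * dist x x0) * (4 * ρ) ≤ (1 + M * Real.sqrt ρ) * (4 * D) := by
      apply mul_le_mul _ _ (by positivity) (by positivity)
      · nlinarith
      · nlinarith [sq_nonneg ε]
    have h5 : (hF' (yF k R ε x0 x)) ^ 2 ≤ 1 :=
      pow_le_one₀ (hF'_nonneg _) (hF'_le _)
    have h6 : (hF' (yF k R ε x0 x) * (-(1 / 2) / D)) ^ 2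
        = (hF' (yF k R ε x0 x)) ^ 2 * (1 / (4 * D ^ 2)) := by
      field_simp; ring
    rw [h6]
    calc _ ≤ 1 * (1 / (4 * D ^ 2)) * ((1 + M * Real.sqrt ρ) * (4 * D)) := by
          apply mul_le_mul _ (h2.trans h4) (KHform_nonneg _ _ _) (by positivity)
          exact mul_le_mul_of_nonneg_right h5 (by positivity)
      _ = _ := by field_simp
  · rw [GF, indicator_of_notMem (by exact h),
      hF'_of_nonpos _ (yF_nonpos k R ε hR hε x0 x (not_lt.1 h))]
    simp

lemma exists_test (k : ℝ) (hk : 0 < k) (Ω : Set (ℝ × ℝ)) (hΩo : IsOpen Ω)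
    (q : ℝ × ℝ → ℝ) (hq1 : ContDiffOn ℝ 2 q Ω) (x0 : ℝ × ℝ) (hx0 : x0 ∈ Ω) :
    ∃ C0 : ℝ, 0 ≤ C0 ∧ ∃ c > 0, ∃ ε0 > 0, ∀ ε, 0 < ε → ε < ε0 → ∃ v : ℝ × ℝ → ℝ,
      ContDiff ℝ 1 v ∧ (∀ x, x ∉ Ω → v x = 0) ∧
      (∫ x in Ω, KHform k x (grad v x) (grad v x))
        ≤ Real.sqrt (detKH k x0) * (2 * π * (Real.log (1 / ε) + C0)) ∧
      Metric.ball x0 (c * ε) ⊆ Ω ∧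
      ∀ x ∈ Metric.ball x0 (c * ε), Real.log (1 / ε) - C0 ≤ v x ∧ q x ≤ q x0 + C0 * ε := by
  obtain ⟨M, hM, r, hr, hK⟩ := KHform_pert k hk x0
  have hqc : ContDiffAt ℝ 1 q x0 :=
    (hq1.contDiffAt (hΩo.mem_nhds hx0)).of_le (by norm_num)
  obtain ⟨Kq, t, ht, hL⟩ := hqc.exists_lipschitzOnWith
  obtain ⟨R, hR, hRsub⟩ := Metric.mem_nhds_iff.1
    (inter_mem (inter_mem ht (hΩo.mem_nhds hx0)) (Metric.ball_mem_nhds x0 hr))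
  -- shrink so that `R ≤ r`
  set R' := min R r with hR'
  have hR'p : 0 < R' := lt_min hR hr
  set N := 2 * (1 + (x0.1 ^ 2 + x0.2 ^ 2) / k ^ 2) with hN
  have hN1 : 1 ≤ N := by
    have : 0 ≤ (x0.1 ^ 2 + x0.2 ^ 2) / k ^ 2 := by positivity
    rw [hN]; linarith
  have hN0 : 0 < N := by linarith
  set C1 := 1 / 2 + |1 / 2 * (Real.log (R' ^ 2) - Real.log 2)| with hC1
  set C2 := |1 / 2 * Real.log (R' ^ 2 + 1)| + M * R' with hC2
  have hC1n : 0 ≤ C1 := by positivity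
  have hC2n : 0 ≤ C2 := by positivity
  have hKq : (0:ℝ) ≤ Kq := Kq.2
  refine ⟨C1 + C2 + Kq, by positivity, 1 / N, by positivity, min 1 R', lt_min one_pos hR'p, ?_⟩
  intro ε hε hε0
  have hε1 : ε < 1 := hε0.trans_le (min_le_left _ _)
  have hεR : ε < R' := hε0.trans_le (min_le_right _ _)
  have hlog : Real.log (ε ^ 2) = -2 * Real.log (1 / ε) := by
    rw [Real.log_pow, one_div, Real.log_inv]; push_cast; ring
  have hballε : Metric.ball x0 (1 / N * ε) ⊆ Metric.ball x0 R := by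
    apply Metric.ball_subset_ball
    have : 1 / N ≤ 1 := by rw [div_le_one hN0]; exact hN1
    have h2 : R' ≤ R := min_le_left _ _
    nlinarith
  refine ⟨vF k R' ε x0, vF_contDiff k R' ε x0 hε, ?_, ?_, ?_, ?_⟩
  · intro x hx
    apply hF_of_nonpos
    apply yF_nonpos k R' ε hR'p hε
    by_contra hlt
    have h1 : dist x x0 < R' :=
      lt_of_pow_lt_pow_left₀ 2 hR'p.le (lt_of_le_of_lt (dist_sq_le_rhoF k x0 x) (not_le.1 hlt))
    exact hx (hRsub (Metric.mem_ball.2 (h1.trans_le (min_le_left _ _)))).1.2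
  · calc (∫ x in Ω, KHform k x (grad (vF k R' ε x0) x) (grad (vF k R' ε x0) x))
        ≤ ∫ x in Ω, GF R' ε M (rhoF k x0 x) := by
          refine integral_mono_of_nonneg ?_ ?_ ?_
          · exact Eventually.of_forall fun x => KHform_nonneg _ _ _
          · exact (GF_integrable k x0 R' ε M hR'p hε).integrableOn
          · exact Eventually.of_forall fun x =>
              energy_pointwise k hk x0 M r R' ε hM hR'p (min_le_right _ _) hε hK x
      _ ≤ ∫ x, GF R' ε M (rhoF k x0 x) :=
          setIntegral_le_integral (GF_integrable k x0 R' ε M hR'p hε)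
            (Eventually.of_forall fun x => GF_nonneg _ _ _ hM _ (rhoF_nonneg _ _ _))
      _ ≤ _ := GF_integral k hk x0 R' ε M hR'p hε hM
      _ ≤ _ := by
          refine mul_le_mul_of_nonneg_left ?_ (Real.sqrt_nonneg _)
          refine mul_le_mul_of_nonneg_left ?_ (by positivity)
          have h1 : Real.log (R' ^ 2 + ε ^ 2) ≤ Real.log (R' ^ 2 + 1) :=
            Real.log_le_log (by positivity) (by nlinarith)
          have h2 := le_abs_self (1 / 2 * Real.log (R' ^ 2 + 1))
          rw [hlog]
          linarith
  · exact fun x hx => (hRsub (hballε hx)).1.2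
  · intro x hx
    have hxd : dist x x0 < 1 / N * ε := hx
    constructor
    · refine le_trans ?_ (le_hF _)
      unfold yF
      have hρ : rhoF k x0 x ≤ ε ^ 2 := by
        refine (rhoF_le k hk x0 x).trans ?_
        rw [← hN, ← mul_pow]
        apply pow_le_pow_left₀ (by positivity)
        have : N * dist x x0 ≤ N * (1 / N * ε) := mul_le_mul_of_nonneg_left hxd.le hN0.le
        have e : N * (1 / N * ε) = ε := by field_simp
        linarith
      have h1 : Real.log (rhoF k x0 x + ε ^ 2) ≤ Real.log 2 + Real.log (ε ^ 2) := by
        rw [← Real.log_mul (by norm_num) (by positivity)]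
        exact Real.log_le_log (by have := rhoF_nonneg k x0 x; positivity) (by linarith)
      have h2 := neg_abs_le (1 / 2 * (Real.log (R' ^ 2) - Real.log 2))
      rw [hlog] at h1
      linarith
    · have hd := hL.dist_le_mul x (hRsub (hballε hx)).1.1 x0 (mem_of_mem_nhds ht)
      rw [Real.dist_eq] at hd
      have h1 := (le_abs_self _).trans hd
      have h3 : dist x x0 ≤ ε := by
        refine hxd.le.trans ?_
        have : 1 / N ≤ 1 := by rw [div_le_one hN0]; exact hN1
        nlinarith
      have h2 : (Kq : ℝ) * dist x x0 ≤ Kq * ε := mul_le_mul_of_nonneg_left h3 hKq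
      have h4 : 0 ≤ (C1 + C2) * ε := by positivity
      linarith

lemma KHform_cont (k : ℝ) (hk : 0 < k) (v : ℝ × ℝ → ℝ) (hv : ContDiff ℝ 1 v) :
    Continuous (fun x => KHform k x (grad v x) (grad v x)) := by
  have hc : Continuous (fun x => fderiv ℝ v x) := hv.continuous_fderiv (by norm_num)
  have h1 : Continuous (fun x => fderiv ℝ v x (1, 0)) := hc.clm_apply continuous_const
  have h2 : Continuous (fun x => fderiv ℝ v x (0, 1)) := hc.clm_apply continuous_const
  unfold KHform grad
  refine Continuous.mul (Continuous.inv₀ (by fun_prop) (fun x => by positivity)) ?_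
  fun_prop

lemma grad_const_mul (c : ℝ) (v : ℝ × ℝ → ℝ) (hv : ContDiff ℝ 1 v) (x : ℝ × ℝ) :
    grad (fun y => c * v y) x = c • grad v x := by
  have hd : DifferentiableAt ℝ v x := (hv.differentiable (by norm_num)) x
  unfold grad
  rw [fderiv_const_mul hd]
  ext <;> simp

lemma KHform_const_mul (k c : ℝ) (v : ℝ × ℝ → ℝ) (hv : ContDiff ℝ 1 v) (Ω : Set (ℝ × ℝ)) :
    (∫ x in Ω, KHform k x (grad (fun y => c * v y) x) (grad (fun y => c * v y) x))
      = c ^ 2 * ∫ x in Ω, KHform k x (grad v x) (grad v x) := by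
  simp_rw [grad_const_mul c v hv, KHform_smul]
  rw [integral_const_mul]

lemma pPart_rpow_nonneg (t s : ℝ) : 0 ≤ pPart t ^ s := Real.rpow_nonneg (le_max_right _ _) _

lemma Ieps_zero (k p ε : ℝ) (hp : 1 < p) (hε : 0 < ε) (hε1 : ε < 1) (q : ℝ × ℝ → ℝ)
    (Ω : Set (ℝ × ℝ)) (hΩo : IsOpen Ω) (hq3 : ∀ x ∈ closure Ω, 0 < q x) :
    Ieps k p ε q Ω (fun _ => 0) = 0 := by
  have hL : 0 < Real.log (1 / ε) := Real.log_pos (by rw [lt_div_iff₀ hε]; linarith)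
  unfold Ieps
  have h1 : ∫ x in Ω, pPart (0 - q x * Real.log (1 / ε)) ^ (p + 1) = ∫ x in Ω, (0:ℝ) := by
    apply setIntegral_congr_fun hΩo.measurableSet
    intro x hx
    have : 0 < q x * Real.log (1 / ε) := mul_pos (hq3 x (subset_closure hx)) hL
    simp only [pPart]
    rw [max_eq_right (by linarith), Real.zero_rpow (by linarith)]
  have h2 : ∀ x, KHform k x (grad (fun _ => 0) x) (grad (fun _ => 0) x) = 0 := by
    intro x; simp [grad, KHform]
  rw [h1]; simp [h2]

lemma ceps_set_nonneg (k p ε : ℝ) (hp : 1 < p) (hε : 0 < ε) (hε1 : ε < 1) (q : ℝ × ℝ → ℝ)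
    (Ω : Set (ℝ × ℝ)) (hΩo : IsOpen Ω) (hq3 : ∀ x ∈ closure Ω, 0 < q x)
    (γ : ℝ → ℝ × ℝ → ℝ) (h0 : γ 0 = (fun _ => 0)) :
    0 ≤ sSup ((fun t => Ieps k p ε q Ω (γ t)) '' Icc (0:ℝ) 1) := by
  by_cases hb : BddAbove ((fun t => Ieps k p ε q Ω (γ t)) '' Icc (0:ℝ) 1)
  · apply le_csSup hb
    exact ⟨0, by simp, by simp only [h0]; exact Ieps_zero k p ε hp hε hε1 q Ω hΩo hq3⟩
  · rw [Real.sSup_of_not_bddAbove hb]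

lemma ceps_nonneg (k p ε : ℝ) (hp : 1 < p) (hε : 0 < ε) (hε1 : ε < 1) (q : ℝ × ℝ → ℝ)
    (Ω : Set (ℝ × ℝ)) (hΩo : IsOpen Ω) (hq3 : ∀ x ∈ closure Ω, 0 < q x) :
    0 ≤ ceps k p q Ω ε := by
  apply Real.sInf_nonneg
  rintro c ⟨γ, -, -, h0, -, rfl⟩
  exact ceps_set_nonneg k p ε hp hε hε1 q Ω hΩo hq3 γ h0

lemma ceps_le (k p ε : ℝ) (hk : 0 < k) (hp : 1 < p) (hε : 0 < ε) (hε1 : ε < 1) (q : ℝ × ℝ → ℝ)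
    (Ω : Set (ℝ × ℝ)) (hΩo : IsOpen Ω) (hΩb : Bornology.IsBounded Ω)
    (hq3 : ∀ x ∈ closure Ω, 0 < q x) (v : ℝ × ℝ → ℝ) (hv : ContDiff ℝ 1 v)
    (hv0 : ∀ x, x ∉ Ω → v x = 0) (B : ℝ)
    (hB : ∀ τ, 0 ≤ τ → Ieps k p ε q Ω (fun x => τ * v x) ≤ B)
    (hT : ∃ T, 0 ≤ T ∧ Ieps k p ε q Ω (fun x => T * v x) < 0) :
    ceps k p q Ω ε ≤ B := by
  obtain ⟨T, hT0, hT⟩ := hT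
  let γ : ℝ → ℝ × ℝ → ℝ := fun t x => t * T * v x
  have hγ0 : γ 0 = fun _ => 0 := by ext x; simp [γ]
  have hbdd : BddBelow {c | ∃ γ : ℝ → ℝ × ℝ → ℝ,
    (∀ t ∈ Icc (0:ℝ) 1, MemH k Ω (γ t)) ∧
    (∀ t ∈ Icc (0:ℝ) 1, ∀ δ > 0, ∃ η > 0, ∀ s ∈ Icc (0:ℝ) 1, |s - t| < η →
      (∫ x in Ω, KHform k x (grad (fun y => γ s y - γ t y) x)
        (grad (fun y => γ s y - γ t y) x)) < δ) ∧
    γ 0 = (fun _ => 0) ∧ Ieps k p ε q Ω (γ 1) < 0 ∧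
    c = sSup ((fun t => Ieps k p ε q Ω (γ t)) '' Icc (0:ℝ) 1)} := by
    refine ⟨0, ?_⟩
    rintro c ⟨γ, -, -, h0, -, rfl⟩
    exact ceps_set_nonneg k p ε hp hε hε1 q Ω hΩo hq3 γ h0
  refine (csInf_le hbdd ⟨γ, ?_, ?_, hγ0, ?_, rfl⟩).trans ?_
  · intro t _
    have hc : ContDiff ℝ 1 (γ t) := contDiff_const.mul hv
    refine ⟨hc.continuous.continuousOn, hc.contDiffOn, ?_, ?_⟩
    · intro x hx
      have : x ∉ Ω := by
        rw [hΩo.frontier_eq] at hx; exact hx.2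
      simp [γ, hv0 x this]
    · have hcpt : IsCompact (closure Ω) := hΩb.isCompact_closure
      exact ((KHform_cont k hk _ hc).continuousOn.integrableOn_compact hcpt).mono_set subset_closure
  · intro t _ δ hδ
    set E := ∫ x in Ω, KHform k x (grad v x) (grad v x) with hE
    have hE0 : 0 ≤ E := integral_nonneg fun x => KHform_nonneg _ _ _
    have hP : 0 < T ^ 2 * E + 1 := by positivity
    refine ⟨min 1 (δ / (T ^ 2 * E + 1)), lt_min one_pos (by positivity), ?_⟩
    intro s _ hs
    have e1 : (fun y => γ s y - γ t y) = fun y => ((s - t) * T) * v y := by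
      ext y; simp only [γ]; ring
    rw [e1, KHform_const_mul k _ v hv, ← hE]
    have h1 : |s - t| < 1 := hs.trans_le (min_le_left _ _)
    have h2 : |s - t| < δ / (T ^ 2 * E + 1) := hs.trans_le (min_le_right _ _)
    rw [lt_div_iff₀ hP] at h2
    have h3 : (s - t) ^ 2 ≤ |s - t| := by
      rw [← sq_abs]; nlinarith [abs_nonneg (s - t)]
    have h4 : (s - t) ^ 2 * (T ^ 2 * E) ≤ |s - t| * (T ^ 2 * E) :=
      mul_le_mul_of_nonneg_right h3 (by positivity)
    nlinarith [abs_nonneg (s - t)]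
  · simpa [γ] using hT
  · apply csSup_le ((nonempty_Icc.2 zero_le_one).image _)
    rintro _ ⟨t, ht, rfl⟩
    exact hB (t * T) (mul_nonneg ht.1 hT0)

lemma tendsto_aux (a b κ C p : ℝ) (ha : 0 ≤ a) (hκ : 0 < κ) (hC : 0 ≤ C) (hp : 1 < p) :
    Tendsto (fun σ : ℝ => a * σ + b * σ ^ 2 - κ * (max (σ / 2 - C) 0) ^ (p + 1)) atTop atBot := by
  have h1 : Tendsto (fun σ : ℝ => (σ / 4) ^ (p - 1)) atTop atTop :=
    (tendsto_rpow_atTop (by linarith)).comp (tendsto_id.atTop_div_const (by norm_num))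
  have h2 : Tendsto (fun σ : ℝ => (a + b) + (-(κ / 16)) * (σ / 4) ^ (p - 1)) atTop atBot :=
    tendsto_atBot_add_const_left _ _ (h1.const_mul_atTop_of_neg (by linarith))
  have h3 : Tendsto (fun σ : ℝ => σ ^ 2) atTop atTop := tendsto_pow_atTop (by norm_num)
  refine tendsto_atBot_mono' _ ?_ (h3.atTop_mul_atBot₀ h2)
  filter_upwards [eventually_ge_atTop (1:ℝ), eventually_ge_atTop (4 * C)] with σ h1 h4
  have hσ : 0 < σ / 4 := by linarith
  have e1 : (σ / 4) ^ (p + 1) ≤ (max (σ / 2 - C) 0) ^ (p + 1) := by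
    apply Real.rpow_le_rpow hσ.le _ (by linarith)
    exact le_max_of_le_left (by linarith)
  have e2 : (σ / 4) ^ (p + 1) = (σ / 4) ^ (p - 1) * (σ / 4) ^ 2 := by
    rw [← Real.rpow_natCast (σ / 4) 2, ← Real.rpow_add hσ]; congr 1; push_cast; ring
  rw [e2] at e1
  have e3 := mul_le_mul_of_nonneg_left e1 hκ.le
  have e4 : a * σ ≤ a * σ ^ 2 := mul_le_mul_of_nonneg_left (by nlinarith) ha
  linarith

lemma Ieps_upper (k p ε : ℝ) (hp : 1 < p) (hε : 0 < ε)
    (q : ℝ × ℝ → ℝ) (Ω : Set (ℝ × ℝ)) (hΩb : Bornology.IsBounded Ω)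
    (hqc : ContinuousOn q (closure Ω)) (v : ℝ × ℝ → ℝ) (hv : ContDiff ℝ 1 v)
    (x0 : ℝ × ℝ) (c C0 B τ : ℝ) (hc : 0 < c) (hτ : 0 ≤ τ)
    (hL : 0 ≤ Real.log (1 / ε))
    (hE : (∫ x in Ω, KHform k x (grad v x) (grad v x)) ≤ B)
    (hball : Metric.ball x0 (c * ε) ⊆ Ω)
    (hlow : ∀ x ∈ Metric.ball x0 (c * ε),
      Real.log (1 / ε) - C0 ≤ v x ∧ q x ≤ q x0 + C0 * ε) :
    Ieps k p ε q Ω (fun x => τ * v x) ≤ 1 / 2 * (τ ^ 2 * B)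
      - 4 * c ^ 2 / (p + 1) * (max (τ * (Real.log (1 / ε) - C0)
          - (q x0 + C0 * ε) * Real.log (1 / ε)) 0) ^ (p + 1) := by
  unfold Ieps
  rw [KHform_const_mul k τ v hv]
  set L := Real.log (1 / ε)
  set m := max (τ * (L - C0) - (q x0 + C0 * ε) * L) 0 with hm
  have hm0 : 0 ≤ m := le_max_right _ _
  have hint : IntegrableOn (fun x => pPart (τ * v x - q x * L) ^ (p + 1)) Ω := by
    have hco : ContinuousOn (fun x => pPart (τ * v x - q x * L) ^ (p + 1)) (closure Ω) := by
      apply ContinuousOn.rpow_const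
      · unfold pPart
        have h1 : ContinuousOn (fun x => τ * v x - q x * L) (closure Ω) :=
          (continuousOn_const.mul hv.continuous.continuousOn).sub (hqc.mul continuousOn_const)
        exact ContinuousOn.sup h1 continuousOn_const
      · intro x _; right; linarith
    exact (hco.integrableOn_compact hΩb.isCompact_closure).mono_set subset_closure
  have hvol : volume.real (Metric.ball x0 (c * ε)) = 4 * c ^ 2 * ε ^ 2 := by
    have hx : Metric.ball x0 (c * ε) = Metric.ball x0.1 (c * ε) ×ˢ Metric.ball x0.2 (c * ε) := by
      rw [ball_prod_same]
    rw [hx, Measure.volume_eq_prod, measureReal_def, Measure.prod_prod, Real.volume_ball,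
      Real.volume_ball, ENNReal.toReal_mul, ENNReal.toReal_ofReal (by positivity)]
    ring
  have h1 : m ^ (p + 1) * (4 * c ^ 2 * ε ^ 2)
      ≤ ∫ x in Ω, pPart (τ * v x - q x * L) ^ (p + 1) := by
    calc m ^ (p + 1) * (4 * c ^ 2 * ε ^ 2)
        = ∫ x in Metric.ball x0 (c * ε), m ^ (p + 1) := by
          rw [setIntegral_const, hvol, smul_eq_mul]; ring
      _ ≤ ∫ x in Metric.ball x0 (c * ε), pPart (τ * v x - q x * L) ^ (p + 1) := by
          apply setIntegral_mono_on
          · exact integrableOn_const (measure_ball_lt_top.ne)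
          · exact hint.mono_set hball
          · exact measurableSet_ball
          · intro x hx
            obtain ⟨h2, h3⟩ := hlow x hx
            apply Real.rpow_le_rpow hm0 _ (by linarith)
            rw [hm, pPart]
            apply max_le_max_right
            have := mul_le_mul_of_nonneg_left h2 hτ
            have := mul_le_mul_of_nonneg_right h3 hL
            linarith
      _ ≤ _ := setIntegral_mono_set hint
          (Eventually.of_forall fun x => pPart_rpow_nonneg _ _) hball.eventuallyLE
  have h2 : 4 * c ^ 2 / (p + 1) * m ^ (p + 1)
      = 1 / ((p + 1) * ε ^ 2) * (m ^ (p + 1) * (4 * c ^ 2 * ε ^ 2)) := by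
    have : p + 1 ≠ 0 := by linarith
    field_simp
  rw [h2]
  have h3 := mul_le_mul_of_nonneg_left h1 (show 0 ≤ 1 / ((p + 1) * ε ^ 2) by
    have : 0 < p + 1 := by linarith
    positivity)
  have h4 := mul_le_mul_of_nonneg_left hE (sq_nonneg τ)
  linarith

lemma eventually_small (C0 : ℝ) : ∀ᶠ ε in 𝓝[>] (0:ℝ), 0 < ε ∧ ε < 1 ∧ 1 ≤ Real.log (1 / ε) ∧
    2 * C0 ≤ Real.log (1 / ε) ∧ ε * Real.log (1 / ε) ≤ 1 := by
  have hL : Tendsto (fun ε : ℝ => Real.log (1 / ε)) (𝓝[>] 0) atTop := by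
    simp_rw [one_div]
    exact Real.tendsto_log_atTop.comp tendsto_inv_nhdsGT_zero
  filter_upwards [self_mem_nhdsWithin, Ioo_mem_nhdsGT (show (0:ℝ) < 1 by norm_num),
    hL.eventually_ge_atTop 1, hL.eventually_ge_atTop (2 * C0)] with ε h1 h2 h3 h4
  have h0 : 0 < ε := h1
  refine ⟨h1, h2.2, h3, h4, ?_⟩
  have := Real.log_le_self (show 0 ≤ 1 / ε by positivity)
  have h5 := mul_le_mul_of_nonneg_left this h0.le
  rwa [mul_one_div_cancel h0.ne'] at h5

lemma ceps_upper (k p : ℝ) (hk : 0 < k) (hp : 1 < p)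
    (Ω : Set (ℝ × ℝ)) (hΩo : IsOpen Ω) (hΩb : Bornology.IsBounded Ω)
    (q : ℝ × ℝ → ℝ) (hq1 : ContDiffOn ℝ 2 q Ω) (hqc : ContinuousOn q (closure Ω))
    (hq3 : ∀ x ∈ closure Ω, 0 < q x) (x0 : ℝ × ℝ) (hx0 : x0 ∈ Ω) :
    ∃ C : ℝ, ∀ᶠ ε in 𝓝[>] (0:ℝ),
      ceps k p q Ω ε ≤ π * Qfun k q x0 * Real.log (1 / ε) + C := by
  obtain ⟨C0, hC0, c, hc, ε0, hε0, htest⟩ := exists_test k hk Ω hΩo q hq1 x0 hx0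
  set A := Real.sqrt (detKH k x0) with hA
  have hA0 : 0 ≤ A := Real.sqrt_nonneg _
  set q0 := q x0 with hq0
  have hq0p : 0 < q0 := hq3 x0 (subset_closure hx0)
  set κ := 4 * c ^ 2 / (p + 1) with hκ
  have hp1 : 0 < p + 1 := by linarith
  have hκp : 0 < κ := by positivity
  have hπ := pi_pos
  set f : ℝ → ℝ := fun σ => (4 * π * A * q0) * σ + (2 * π * A) * σ ^ 2
    - κ * (max (σ / 2 - (q0 + 1) * C0) 0) ^ (p + 1) with hf
  have hft : Tendsto f atTop atBot :=
    tendsto_aux _ _ κ _ p (by positivity) hκp (by positivity) hp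
  obtain ⟨S0, hS0⟩ := eventually_atTop.1 (hft.eventually_le_atBot 0)
  set S := max S0 0
  have hSn : 0 ≤ S := le_max_right _ _
  set C3 := (4 * π * A * q0) * S + (2 * π * A) * S ^ 2 with hC3
  have hC3n : 0 ≤ C3 := by positivity
  have hfle : ∀ σ, 0 ≤ σ → f σ ≤ C3 := by
    intro σ hσ
    by_cases h : S ≤ σ
    · exact (hS0 σ ((le_max_left _ _).trans h)).trans hC3n
    · have hlt : σ ≤ S := (not_le.1 h).le
      have : 0 ≤ κ * (max (σ / 2 - (q0 + 1) * C0) 0) ^ (p + 1) :=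
        mul_nonneg hκp.le (Real.rpow_nonneg (le_max_right _ _) _)
      have e1 : (4 * π * A * q0) * σ ≤ (4 * π * A * q0) * S :=
        mul_le_mul_of_nonneg_left hlt (by positivity)
      have e2 : (2 * π * A) * σ ^ 2 ≤ (2 * π * A) * S ^ 2 :=
        mul_le_mul_of_nonneg_left (pow_le_pow_left₀ hσ hlt 2) (by positivity)
      simp only [hf]; linarith
  refine ⟨π * A * q0 ^ 2 * C0 + C3, ?_⟩
  filter_upwards [eventually_small C0, Ioo_mem_nhdsGT hε0] with ε hε hε'
  obtain ⟨hεp, hε1, hL1, hLC, hεL⟩ := hε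
  obtain ⟨v, hv, hv0, hE, hball, hlow⟩ := htest ε hεp hε'.2
  set L := Real.log (1 / ε) with hLdef
  have hLp : 0 < L := by linarith
  have hup := fun τ hτ => Ieps_upper k p ε hp hεp q Ω hΩb hqc v hv x0 c C0 _ τ hc hτ hLp.le hE
    hball hlow
  have hQ : Qfun k q x0 = q0 ^ 2 * A := rfl
  rw [hQ]
  -- bound for `τ = q0 + σ / L`
  have hσ : ∀ σ, 0 ≤ σ → Ieps k p ε q Ω (fun x => (q0 + σ / L) * v x)
      ≤ π * (q0 ^ 2 * A) * L + π * A * q0 ^ 2 * C0 + f σ := by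
    intro σ hσ
    have hτ : 0 ≤ q0 + σ / L := by positivity
    refine (hup _ hτ).trans ?_
    have hsL : σ / L * L = σ := by field_simp
    set s := σ / L with hs
    have hs0 : 0 ≤ s := by positivity
    have hsC : s * C0 ≤ σ / 2 := by nlinarith
    have hss : s ≤ σ := by nlinarith
    have m1 : max (σ / 2 - (q0 + 1) * C0) 0 ≤ max ((q0 + s) * (L - C0) - (q0 + C0 * ε) * L) 0 := by
      apply max_le_max_right
      have : C0 * (ε * L) ≤ C0 * 1 := mul_le_mul_of_nonneg_left hεL hC0
      nlinarith
    have m2 := mul_le_mul_of_nonneg_left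
      (Real.rpow_le_rpow (le_max_right _ _) m1 hp1.le) hκp.le
    have m3 : (q0 + s) ^ 2 * (L + C0) ≤ q0 ^ 2 * L + q0 ^ 2 * C0 + 4 * q0 * σ + 2 * σ ^ 2 := by
      have a1 : (q0 + s) ^ 2 * (L + C0) = q0 ^ 2 * L + q0 ^ 2 * C0
          + 2 * q0 * (s * L + s * C0) + s * (s * L + s * C0) := by ring
      rw [a1, hsL]
      have a2 : q0 * (σ + s * C0) ≤ q0 * (2 * σ) :=
        mul_le_mul_of_nonneg_left (by linarith) hq0p.le
      have a3 : s * (σ + s * C0) ≤ σ * (2 * σ) :=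
        mul_le_mul hss (by linarith) (by positivity) hσ
      nlinarith
    have m4 := mul_le_mul_of_nonneg_left m3 (show 0 ≤ π * A by positivity)
    simp only [hf]
    linarith
  apply ceps_le k p ε hk hp hεp hε1 q Ω hΩo hΩb hq3 v hv hv0
  · intro τ hτ
    by_cases h : τ ≤ q0
    · refine (hup τ hτ).trans ?_
      have hn : 0 ≤ κ * (max (τ * (L - C0) - (q0 + C0 * ε) * L) 0) ^ (p + 1) :=
        mul_nonneg hκp.le (Real.rpow_nonneg (le_max_right _ _) _)
      have h1 : τ ^ 2 ≤ q0 ^ 2 := pow_le_pow_left₀ hτ h 2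
      have h2 := mul_le_mul_of_nonneg_left h1 (show 0 ≤ π * A * (L + C0) by positivity)
      linarith
    · have h1 := hσ ((τ - q0) * L) (mul_nonneg (by linarith) hLp.le)
      have h2 : q0 + (τ - q0) * L / L = τ := by field_simp; ring
      rw [h2] at h1
      have h3 := hfle ((τ - q0) * L) (mul_nonneg (by linarith) hLp.le)
      linarith
  · obtain ⟨σ, h1, h2⟩ := ((hft.eventually_lt_atBot
      (-(π * (q0 ^ 2 * A) * L + π * A * q0 ^ 2 * C0))).and (eventually_ge_atTop 0)).exists
    refine ⟨q0 + σ / L, by positivity, ?_⟩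
    have := hσ σ h2
    linarith

/-- Proposition 3.1: upper bound for the mountain pass value.  If
some minimum point `x*` of `q²√(det K_H)` over `Ω̄` lies on the `x₁`-axis, then
`limsup_{ε→0} c_ε/ln(1/ε) ≤ π q²(x*)√(det K_H(x*)) = π min_{Ω̄} q²√(det K_H)`;
if moreover `x* ∈ Ω`, then `c_ε ≤ π (min_{Ω̄} q²√(det K_H)) ln(1/ε) + O(1)`. -/
theorem statement9 (k p : ℝ) (hk : 0 < k) (hp : 1 < p)
    (Ω : Set (ℝ × ℝ)) (hΩo : IsOpen Ω) (hΩc : IsConnected Ω)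
    (hΩb : Bornology.IsBounded Ω) (hΩsc : SimplyConnectedSpace ↥Ω)
    (q : ℝ × ℝ → ℝ) (hq1 : ContDiffOn ℝ 2 q Ω) (hq2 : ContDiffOn ℝ 1 q (closure Ω))
    (hq3 : ∀ x ∈ closure Ω, 0 < q x) (hq4 : ∀ x ∈ Ω, LH k q x = 0)
    (xstar : ℝ × ℝ) (hx1 : xstar ∈ closure Ω) (hx2 : xstar.2 = 0)
    (hxmin : ∀ y ∈ closure Ω, Qfun k q xstar ≤ Qfun k q y) :
    limsup (fun ε => ceps k p q Ω ε / Real.log (1 / ε)) (𝓝[>] (0:ℝ))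
        ≤ π * Qfun k q xstar ∧
    π * Qfun k q xstar = π * sInf (Qfun k q '' closure Ω) ∧
    (xstar ∈ Ω → ∃ C : ℝ, ∀ᶠ ε in 𝓝[>] (0:ℝ),
      ceps k p q Ω ε ≤ π * sInf (Qfun k q '' closure Ω) * Real.log (1 / ε) + C) := by

  have hqc : ContinuousOn q (closure Ω) := hq2.continuousOn
  have hQc : ContinuousOn (Qfun k q) (closure Ω) := by
    have h1 : Continuous (fun x => detKH k x) := by
      unfold detKH
      exact continuous_const.div (by fun_prop) (fun x => by positivity)
    exact (hqc.pow 2).mul h1.sqrt.continuousOn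
  have hmin : Qfun k q xstar = sInf (Qfun k q '' closure Ω) := by
    have hl : IsLeast (Qfun k q '' closure Ω) (Qfun k q xstar) := by
      refine ⟨⟨xstar, hx1, rfl⟩, ?_⟩
      rintro _ ⟨y, hy, rfl⟩
      exact hxmin y hy
    exact hl.csInf_eq.symm
  refine ⟨?_, by rw [hmin], ?_⟩
  · apply le_of_forall_pos_le_add
    intro δ hδ
    -- an interior point whose value is close to the minimum
    have hcw : ContinuousWithinAt (Qfun k q) Ω xstar :=
      (hQc xstar hx1).mono subset_closure
    have hπ := pi_pos
    have hlt : ∀ᶠ x in 𝓝[Ω] xstar, Qfun k q x < Qfun k q xstar + δ / (2 * π) :=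
      hcw.eventually_lt_const (by have : 0 < δ / (2 * π) := by positivity
                                  linarith)
    have : (𝓝[Ω] xstar).NeBot := mem_closure_iff_nhdsWithin_neBot.1 hx1
    obtain ⟨x0, h0, hx0⟩ := (hlt.and self_mem_nhdsWithin).exists
    obtain ⟨C, hC⟩ := ceps_upper k p hk hp Ω hΩo hΩb q hq1 hqc hq3 x0 hx0
    have hev : ∀ᶠ ε in 𝓝[>] (0:ℝ),
        ceps k p q Ω ε / Real.log (1 / ε) ≤ π * Qfun k q xstar + δ := by
      filter_upwards [hC, eventually_small (|C| / δ)] with ε h1 h2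
      obtain ⟨_, _, hL1, hL2, _⟩ := h2
      have hLp : 0 < Real.log (1 / ε) := by linarith
      rw [div_le_iff₀ hLp]
      have h3 : C ≤ δ / 2 * Real.log (1 / ε) := by
        have h4 : δ / 2 * (2 * (|C| / δ)) ≤ δ / 2 * Real.log (1 / ε) :=
          mul_le_mul_of_nonneg_left hL2 (by positivity)
        have h5 : δ / 2 * (2 * (|C| / δ)) = |C| := by field_simp
        linarith [le_abs_self C]
      have h6 : π * Qfun k q x0 ≤ π * Qfun k q xstar + δ / 2 := by
        have h7 := mul_le_mul_of_nonneg_left h0.le hπ.le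
        have h8 : π * (Qfun k q xstar + δ / (2 * π)) = π * Qfun k q xstar + δ / 2 := by
          field_simp
        linarith
      have h9 := mul_le_mul_of_nonneg_right h6 hLp.le
      linarith
    refine limsup_le_of_le ?_ hev
    apply IsBoundedUnder.isCoboundedUnder_le
    refine ⟨0, ?_⟩
    rw [eventually_map]
    filter_upwards [eventually_small 0] with ε h
    obtain ⟨h1, h2, h3, _, _⟩ := h
    exact div_nonneg (ceps_nonneg k p ε hp h1 h2 q Ω hΩo hq3) (by linarith)
  · intro hx
    rw [← hmin]
    exact ceps_upper k p hk hp Ω hΩo hΩb q hq1 hqc hq3 xstar hx
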